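/- arXiv:2507.09511 — 3 statements merged into one kernel-verified Lean document; each statement's English description precedes it below -/
import Mathlib

section
/- Let A be an n×n real symmetric matrix and B an m×m principal submatrix of A with m < n. If the eigenvalues of A are λ₁(A) ≥ ... ≥ λₙ(A) and those of B are λ₁(B) ≥ ... ≥ λₘ(B), then for every k with 1 ≤ k ≤ m we have λₖ(A) ≥ λₖ(B), and for every k with n - m < k ≤ m + (n-m), λₖ(B) ≥ λ_{k+n-m}(A) whenever the index is valid. -/
open scoped Classical

/-- The real adjacency matrix of a finite simple graph. -/
noncomputable def adjMat {V : Type*} [Fintype V] [DecidableEq V] (G : SimpleGraph V) :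
    Matrix V V ℝ :=
  Matrix.of fun u v => if G.Adj u v then (1 : ℝ) else 0

/-- The eigenvalues (roots of the characteristic polynomial, with multiplicity) of a real
matrix, listed in nondecreasing order. -/
noncomputable def eigList {V : Type*} [Fintype V] [DecidableEq V] (A : Matrix V V ℝ) : List ℝ :=
  A.charpoly.roots.sort (· ≤ ·)

/-- The `k`-th largest eigenvalue (with multiplicity) of `A`, 1-indexed:
`eig A 1 ≥ eig A 2 ≥ …`. -/
noncomputable def eig {V : Type*} [Fintype V] [DecidableEq V] (A : Matrix V V ℝ) (k : ℕ) : ℝ :=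
  (eigList A).getD ((eigList A).length - k) 0

/-- The `k`-th largest adjacency eigenvalue of a finite simple graph (`λₖ(G)`). -/
noncomputable def graphEig {V : Type*} [Fintype V] [DecidableEq V] (G : SimpleGraph V)
    (k : ℕ) : ℝ :=
  eig (adjMat G) k

/-- The multiplicity of `μ` as an eigenvalue of `A` (dimension of the eigenspace). -/
noncomputable def eigMult {V : Type*} [Fintype V] [DecidableEq V] (A : Matrix V V ℝ)
    (μ : ℝ) : ℕ :=
  Module.finrank ℝ (LinearMap.ker (A.mulVecLin - μ • LinearMap.id))

/-- The number of edges of a finite simple graph. -/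
noncomputable def edgeCount {V : Type*} [Fintype V] (G : SimpleGraph V) : ℕ :=
  G.edgeSet.toFinite.toFinset.card

/-- The cyclomatic number `|E| - |V| + 1` of a (connected) finite graph. -/
noncomputable def cyclomatic {V : Type*} [Fintype V] (G : SimpleGraph V) : ℕ :=
  edgeCount G + 1 - Fintype.card V

/-- The maximum degree of a finite simple graph. -/
noncomputable def maxDeg {V : Type*} [Fintype V] (G : SimpleGraph V) : ℕ :=
  Finset.univ.sup fun v => (G.neighborSet v).toFinite.toFinset.card

/-- The spider `T(ℓ,ℓ,ℓ)`: three paths of length `ℓ` (in edges) sharing exactly their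
initial vertex `none`. -/
def spider (ℓ : ℕ) : SimpleGraph (Option (Fin 3 × Fin ℓ)) :=
  SimpleGraph.fromRel fun u v =>
    match u, v with
    | none, some (_, j) => (j : ℕ) = 0
    | some (i, j), some (i', j') => i = i' ∧ (j' : ℕ) = (j : ℕ) + 1
    | _, _ => False

/-- For a symmetric matrix, the sorted list of eigenvalues is the reverse of `eigenvalues₀`. -/
theorem eigList_eq {N : ℕ} (C : Matrix (Fin N) (Fin N) ℝ) (hC : C.IsHermitian) :
    eigList C = (List.ofFn hC.eigenvalues₀).reverse := by
  unfold eigList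
  have h1 : C.charpoly.roots = ((List.ofFn hC.eigenvalues₀).reverse : Multiset ℝ) := by
    rw [hC.roots_charpoly_eq_eigenvalues₀, Fin.univ_val_map, Multiset.coe_reverse]
    rfl
  rw [h1, Multiset.coe_sort]
  apply List.mergeSort_of_pairwise
  simp_rw [decide_eq_true_eq, List.pairwise_reverse]
  exact List.sortedGE_iff_pairwise.mp hC.eigenvalues₀_antitone.sortedGE_ofFn

theorem eig_eq {N : ℕ} (C : Matrix (Fin N) (Fin N) ℝ) (hC : C.IsHermitian)
    (i : Fin (Fintype.card (Fin N))) :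
    eig C (i + 1) = hC.eigenvalues₀ i := by
  have hi := i.2
  unfold eig
  rw [eigList_eq C hC, List.getD_eq_getElem _ _ (by simp at hi ⊢; omega)]
  rw [List.getElem_reverse, List.getElem_ofFn]
  congr 1
  ext
  simp at hi ⊢
  omega

/-- Ordered spectral decomposition of the quadratic form of a symmetric matrix. -/
theorem spectral_form {N : ℕ} (C : Matrix (Fin N) (Fin N) ℝ) (hC : C.IsHermitian) :
    ∃ v : Fin N → Fin N → ℝ,
      (∀ x : Fin N → ℝ, x ⬝ᵥ x = ∑ i, (v i ⬝ᵥ x) ^ 2) ∧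
      (∀ x : Fin N → ℝ, x ⬝ᵥ C.mulVec x = ∑ i : Fin N, eig C ((i : ℕ) + 1) * (v i ⬝ᵥ x) ^ 2) := by
  set f : Fin (Fintype.card (Fin N)) ≃ Fin N := Fintype.equivOfCardEq (Fintype.card_fin _) with hf
  set g : Fin (Fintype.card (Fin N)) ≃ Fin N := finCongr (Fintype.card_fin N) with hg
  have key : ∀ x y : Fin N → ℝ, x ⬝ᵥ y =
      ∑ i, (⇑(hC.eigenvectorBasis i) ⬝ᵥ x) * (⇑(hC.eigenvectorBasis i) ⬝ᵥ y) := by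
    intro x y
    have h := hC.eigenvectorBasis.sum_inner_mul_inner (WithLp.toLp 2 x) (WithLp.toLp 2 y)
    simp only [EuclideanSpace.inner_eq_star_dotProduct, star_trivial] at h
    rw [dotProduct_comm x y, ← h]
    refine Finset.sum_congr rfl fun i _ => ?_
    rw [dotProduct_comm y]
  have hev : ∀ (i : Fin N) (x : Fin N → ℝ), ⇑(hC.eigenvectorBasis i) ⬝ᵥ C.mulVec x =
      hC.eigenvalues i * (⇑(hC.eigenvectorBasis i) ⬝ᵥ x) := by
    intro i x
    have ht : C.transpose = C := by simpa using hC.eq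
    rw [Matrix.dotProduct_mulVec, ← Matrix.mulVec_transpose, ht, hC.mulVec_eigenvectorBasis,
      smul_dotProduct, smul_eq_mul]
  refine ⟨fun i => ⇑(hC.eigenvectorBasis (f (g.symm i))), fun x => ?_, fun x => ?_⟩
  · rw [key, ← Equiv.sum_comp (g.symm.trans f)]
    exact Finset.sum_congr rfl fun i _ => by simp [sq]
  · rw [key, ← Equiv.sum_comp (g.symm.trans f)]
    refine Finset.sum_congr rfl fun i _ => ?_
    rw [hev]
    have h2 : hC.eigenvalues ((g.symm.trans f) i) = eig C ((i : ℕ) + 1) := by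
      have := eig_eq C hC (g.symm i)
      simp only [hg, finCongr_symm, finCongr_apply, Fin.val_cast] at this
      rw [this]
      simp [Matrix.IsHermitian.eigenvalues, hf, hg]
    rw [h2]
    simp only [Equiv.trans_apply]
    ring

theorem eig_anti {N : ℕ} (C : Matrix (Fin N) (Fin N) ℝ) (hC : C.IsHermitian)
    {i j : ℕ} (hij : i ≤ j) (hj : j < N) : eig C (j + 1) ≤ eig C (i + 1) := by
  have h1 := eig_eq C hC ⟨i, by simp; omega⟩
  have h2 := eig_eq C hC ⟨j, by simp; omega⟩
  simp only at h1 h2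
  rw [h1, h2]
  exact hC.eigenvalues₀_antitone (by simpa using hij)

/-- Fewer than `m` linear conditions have a common nonzero solution. -/
theorem exists_common {m : ℕ} {ι κ : Type} [Fintype ι] [Fintype κ]
    (u : ι → ((Fin m → ℝ) →ₗ[ℝ] ℝ)) (w : κ → ((Fin m → ℝ) →ₗ[ℝ] ℝ))
    (h : Fintype.card ι + Fintype.card κ < m) :
    ∃ x : Fin m → ℝ, x ≠ 0 ∧ (∀ i, u i x = 0) ∧ ∀ j, w j x = 0 := by
  have hk : LinearMap.ker (LinearMap.pi (Sum.elim u w)) ≠ ⊥ := by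
    apply LinearMap.ker_ne_bot_of_finrank_lt
    simpa using h
  obtain ⟨x, hx, hx0⟩ := Submodule.exists_mem_ne_zero_of_ne_bot hk
  have hx' := fun s => congrFun (LinearMap.mem_ker.mp hx) s
  exact ⟨x, hx0, fun i => by simpa using hx' (Sum.inl i), fun j => by simpa using hx' (Sum.inr j)⟩

/-- Extension by zero along `e`. -/
noncomputable def extz {n m : ℕ} (e : Fin m → Fin n) : (Fin m → ℝ) →ₗ[ℝ] (Fin n → ℝ) :=
  ∑ i, (LinearMap.single ℝ (fun _ : Fin n => ℝ) (e i)).comp (LinearMap.proj i)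

theorem dot_extz {n m : ℕ} (e : Fin m → Fin n) (y : Fin n → ℝ) (x : Fin m → ℝ) :
    y ⬝ᵥ extz e x = ∑ i, y (e i) * x i := by
  have : extz e x = ∑ i, Pi.single (e i) (x i) := by
    simp [extz, LinearMap.sum_apply]
  rw [this, dotProduct_sum]
  simp

theorem extz_apply {n m : ℕ} (e : Fin m → Fin n) (he : Function.Injective e)
    (x : Fin m → ℝ) (i : Fin m) : extz e x (e i) = x i := by
  simp [extz, LinearMap.sum_apply, Finset.sum_apply, Pi.single_apply, he.eq_iff]

theorem extz_self {n m : ℕ} (e : Fin m → Fin n) (he : Function.Injective e) (x : Fin m → ℝ) :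
    extz e x ⬝ᵥ extz e x = x ⬝ᵥ x := by
  rw [dot_extz]
  simp only [extz_apply e he, dotProduct]

theorem extz_form {n m : ℕ} (e : Fin m → Fin n) (he : Function.Injective e)
    (A : Matrix (Fin n) (Fin n) ℝ) (x : Fin m → ℝ) :
    extz e x ⬝ᵥ A.mulVec (extz e x) = x ⬝ᵥ (A.submatrix e e).mulVec x := by
  rw [dotProduct_comm, dot_extz, dotProduct_comm]
  simp only [dotProduct, Matrix.mulVec, Matrix.submatrix_apply]
  refine Finset.sum_congr rfl fun i _ => ?_
  congr 1
  exact dot_extz e (fun j => A (e i) j) x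

/-- Comparison of two weighted sums of squares with a constant. -/
theorem sum_le_const {N : ℕ} (l : Fin N → ℝ) (c : ℝ) (a : Fin N → ℝ)
    (h : ∀ i, a i = 0 ∨ l i ≤ c) : ∑ i, l i * a i ^ 2 ≤ c * ∑ i, a i ^ 2 := by
  rw [Finset.mul_sum]
  refine Finset.sum_le_sum fun i _ => ?_
  rcases h i with h | h
  · simp [h]
  · exact mul_le_mul_of_nonneg_right h (sq_nonneg _)

theorem const_le_sum {N : ℕ} (l : Fin N → ℝ) (c : ℝ) (a : Fin N → ℝ)
    (h : ∀ i, a i = 0 ∨ c ≤ l i) : c * ∑ i, a i ^ 2 ≤ ∑ i, l i * a i ^ 2 := by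
  rw [Finset.mul_sum]
  refine Finset.sum_le_sum fun i _ => ?_
  rcases h i with h | h
  · simp [h]
  · exact mul_le_mul_of_nonneg_right h (sq_nonneg _)

/-- The linear functional `x ↦ v ⬝ᵥ x`. -/
noncomputable def dotL {N : ℕ} (v : Fin N → ℝ) : (Fin N → ℝ) →ₗ[ℝ] ℝ where
  toFun x := v ⬝ᵥ x
  map_add' := dotProduct_add v
  map_smul' c x := by simp [dotProduct_smul]

theorem dotL_apply {N : ℕ} (v x : Fin N → ℝ) : dotL v x = v ⬝ᵥ x := rfl

/-- Cauchy's Interlace Theorem. If `B` is an `m × m` principal submatrix of the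
real symmetric `n × n` matrix `A` with `m < n`, then for every `1 ≤ k ≤ m` we have
`λₖ(A) ≥ λₖ(B)` and `λₖ(B) ≥ λ_{k+(n-m)}(A)`. -/
theorem cauchy_interlace {n m : ℕ} (hmn : m < n)
    (A : Matrix (Fin n) (Fin n) ℝ) (hA : A.IsHermitian)
    (e : Fin m → Fin n) (he : Function.Injective e)
    (B : Matrix (Fin m) (Fin m) ℝ) (hB : B = A.submatrix e e) :
    ∀ k : ℕ, 1 ≤ k → k ≤ m →
      eig B k ≤ eig A k ∧ eig A (k + (n - m)) ≤ eig B k := by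
  subst hB
  have hBh : (A.submatrix e e).IsHermitian := hA.submatrix e
  obtain ⟨u, hu1, hu2⟩ := spectral_form A hA
  obtain ⟨v, hv1, hv2⟩ := spectral_form _ hBh
  have hpos : ∀ x : Fin m → ℝ, x ≠ 0 → 0 < x ⬝ᵥ x := by
    intro x hx
    have h0 : 0 ≤ x ⬝ᵥ x := Finset.sum_nonneg fun i _ => mul_self_nonneg _
    exact lt_of_le_of_ne h0 fun h => hx (dotProduct_self_eq_zero.mp h.symm)
  intro k hk1 hkm
  obtain ⟨k, rfl⟩ : ∃ k', k = k' + 1 := ⟨k - 1, by omega⟩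
  constructor
  · obtain ⟨x, hx0, hxv, hxu⟩ := exists_common
      (fun i : Fin (m - (k + 1)) => dotL (v ⟨k + 1 + i, by omega⟩))
      (fun j : Fin k => (dotL (u ⟨j, by omega⟩)).comp (extz e)) (by simp; omega)
    simp only [LinearMap.comp_apply, dotL_apply] at hxv hxu
    have h1 := const_le_sum (fun i => eig (A.submatrix e e) ((i : ℕ) + 1))
      (eig (A.submatrix e e) (k + 1)) (fun i => v i ⬝ᵥ x) (by
        intro i
        by_cases hi : (i : ℕ) ≤ k
        · exact Or.inr (eig_anti _ hBh hi (by omega))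
        · left
          have := hxv ⟨i - (k + 1), by omega⟩
          convert this using 3
          ext; simp; omega)
    have h2 := sum_le_const (fun i => eig A ((i : ℕ) + 1))
      (eig A (k + 1)) (fun i => u i ⬝ᵥ extz e x) (by
        intro i
        by_cases hi : k ≤ (i : ℕ)
        · exact Or.inr (eig_anti _ hA hi i.2)
        · left
          exact hxu ⟨i, by omega⟩)
    rw [← hv2, ← hv1] at h1
    rw [← hu2, ← hu1, extz_self e he, extz_form e he] at h2
    exact le_of_mul_le_mul_right (h1.trans h2) (hpos x hx0)
  · obtain ⟨x, hx0, hxv, hxu⟩ := exists_common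
      (fun i : Fin k => dotL (v ⟨i, by omega⟩))
      (fun j : Fin (m - (k + 1)) =>
        (dotL (u ⟨k + 1 + (n - m) + j, by omega⟩)).comp (extz e)) (by simp; omega)
    simp only [LinearMap.comp_apply, dotL_apply] at hxv hxu
    have h1 := sum_le_const (fun i => eig (A.submatrix e e) ((i : ℕ) + 1))
      (eig (A.submatrix e e) (k + 1)) (fun i => v i ⬝ᵥ x) (by
        intro i
        by_cases hi : k ≤ (i : ℕ)
        · exact Or.inr (eig_anti _ hBh hi i.2)
        · left
          exact hxv ⟨i, by omega⟩)
    have h2 := const_le_sum (fun i => eig A ((i : ℕ) + 1))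
      (eig A (k + (n - m) + 1)) (fun i => u i ⬝ᵥ extz e x) (by
        intro i
        by_cases hi : (i : ℕ) ≤ k + (n - m)
        · exact Or.inr (eig_anti _ hA hi (by omega))
        · left
          have := hxu ⟨i - (k + 1 + (n - m)), by omega⟩
          convert this using 3
          ext; simp; omega)
    rw [← hv2, ← hv1] at h1
    rw [← hu2, ← hu1, extz_self e he, extz_form e he] at h2
    rw [show k + 1 + (n - m) = k + (n - m) + 1 by omega]
    exact le_of_mul_le_mul_right (h2.trans h1) (hpos x hx0)
end

section
/- For all integers p,q ≥ 3 and ℓ ≥ 1, the dumbbell graph B(p,q,ℓ) consisting of two vertex-disjoint cycles of lengths p and q joined by a path of length ℓ has largest adjacency eigenvalue at least 3/√2. -/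
open scoped Classical

/-- Dumbbell graph `B(p,q,ℓ)`: a cycle of length `p` on `Fin p`, a cycle of length `q` on
`Fin q`, joined by a path of length `ℓ` from `Sum.inl 0` to `Sum.inr (Sum.inl 0)` whose
internal vertices are `Fin (ℓ-1)`. -/
def dumbbell (p q ℓ : ℕ) : SimpleGraph (Fin p ⊕ (Fin q ⊕ Fin (ℓ - 1))) :=
  SimpleGraph.fromRel fun u v =>
    match u, v with
    | Sum.inl i, Sum.inl j => (j : ℕ) = ((i : ℕ) + 1) % p
    | Sum.inr (Sum.inl i), Sum.inr (Sum.inl j) => (j : ℕ) = ((i : ℕ) + 1) % q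
    | Sum.inr (Sum.inr s), Sum.inr (Sum.inr t) => (t : ℕ) = (s : ℕ) + 1
    | Sum.inl i, Sum.inr (Sum.inr t) => (i : ℕ) = 0 ∧ (t : ℕ) = 0
    | Sum.inr (Sum.inl i), Sum.inr (Sum.inr t) => (i : ℕ) = 0 ∧ (t : ℕ) = ℓ - 2
    | Sum.inl i, Sum.inr (Sum.inl j) => ℓ = 1 ∧ (i : ℕ) = 0 ∧ (j : ℕ) = 0
    | _, _ => False


lemma le_eig_of_root {V : Type*} [Fintype V] [DecidableEq V] (A : Matrix V V ℝ) (r : ℝ)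
    (hr : r ∈ A.charpoly.roots) : r ≤ eig A 1 := by
  unfold eig
  have hmem : r ∈ eigList A := by
    unfold eigList; rw [Multiset.mem_sort]; exact hr
  have hs : (eigList A).Pairwise (· ≤ ·) := Multiset.pairwise_sort _ _
  obtain ⟨i, hi, rfl⟩ := List.getElem_of_mem hmem
  rw [List.getD_eq_getElem _ _ (by omega)]
  rcases Nat.lt_or_ge i ((eigList A).length - 1) with h | h
  · exact List.pairwise_iff_getElem.1 hs _ _ _ _ h
  · have : i = (eigList A).length - 1 := by omega
    simp [← this]

lemma le_eig_of_sub {V : Type*} [Fintype V] [DecidableEq V] (A : Matrix V V ℝ)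
    (hA : A.IsHermitian) (x : V → ℝ) (hx : ∀ v, 0 < x v) [Nonempty V] (c : ℝ)
    (h : ∀ v, c * x v ≤ ∑ u, A v u * x u) : c ≤ eig A 1 := by
  set M := eig A 1 with hM
  set B : Matrix V V ℝ := algebraMap ℝ _ M - A with hBdef
  have hB : B.IsHermitian := by
    apply Matrix.IsHermitian.sub _ hA
    rw [Matrix.algebraMap_eq_diagonal]
    exact Matrix.isHermitian_diagonal _
  have hP : B.PosSemidef := by
    rw [hB.posSemidef_iff_eigenvalues_nonneg]
    intro i
    have h1 := hB.eigenvalues_mem_spectrum_real i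
    generalize hB.eigenvalues i = μ at h1
    have h2 : M - μ ∈ spectrum ℝ A := by
      rw [spectrum.mem_iff] at h1 ⊢
      intro h3
      apply h1
      rw [hBdef]
      convert h3.neg using 1
      rw [map_sub]; abel
    rw [Matrix.mem_spectrum_iff_isRoot_charpoly] at h2
    have := le_eig_of_root A (M - μ) ((Polynomial.mem_roots (Matrix.charpoly_monic A).ne_zero).2 h2)
    simp only [Pi.zero_apply]
    linarith
  have h5 := hP.dotProduct_mulVec_nonneg x
  have h6 : B.mulVec x = M • x - A.mulVec x := by
    rw [hBdef, Matrix.sub_mulVec, Algebra.algebraMap_eq_smul_one, Matrix.smul_mulVec, Matrix.one_mulVec]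
  rw [h6] at h5
  simp only [dotProduct, Pi.sub_apply, Pi.smul_apply, smul_eq_mul, Matrix.mulVec, star_trivial] at h5
  have h7 : ∑ v, x v * (M * x v - ∑ u, A v u * x u) ≤ ∑ v, x v * (M * x v - c * x v) := by
    apply Finset.sum_le_sum
    intro v _
    apply mul_le_mul_of_nonneg_left _ (hx v).le
    linarith [h v]
  have h8 : ∑ v, x v * (M * x v - c * x v) = (M - c) * ∑ v, x v * x v := by
    rw [Finset.mul_sum]; apply Finset.sum_congr rfl; intros; ring
  have h9 : 0 < ∑ v, x v * x v := Finset.sum_pos (fun v _ => mul_pos (hx v) (hx v)) Finset.univ_nonempty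
  by_contra hc
  push Not at hc
  have : (M - c) * ∑ v, x v * x v < 0 := mul_neg_of_neg_of_pos (by linarith) h9
  linarith

lemma graph_bound {V : Type*} [Fintype V] [DecidableEq V] [Nonempty V] (G : SimpleGraph V)
    (d : V → ℕ)
    (h : ∀ v, (∃ u w, u ≠ w ∧ G.Adj v u ∧ G.Adj v w ∧ d u + 1 ≤ d v ∧ d w ≤ d v + 1) ∨
      (d v = 0 ∧ ∃ s t u, s ≠ t ∧ s ≠ u ∧ t ≠ u ∧ G.Adj v s ∧ G.Adj v t ∧ G.Adj v u ∧
        d s ≤ 1 ∧ d t ≤ 1 ∧ d u ≤ 1)) :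
    3 / Real.sqrt 2 ≤ graphEig G 1 := by
  set a : ℝ := (Real.sqrt 2)⁻¹ with ha
  have hs : 0 < Real.sqrt 2 := by positivity
  have ha0 : 0 < a := by positivity
  have ha2 : a * a = 1 / 2 := by
    rw [ha, ← mul_inv, Real.mul_self_sqrt (by norm_num)]; norm_num
  have ha1 : a ≤ 1 := by nlinarith
  have hpow : ∀ {m n : ℕ}, m ≤ n → a ^ n ≤ a ^ m := fun hmn => pow_le_pow_of_le_one ha0.le ha1 hmn
  apply le_eig_of_sub _ _ (fun v => a ^ d v) (fun v => by positivity)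
  · intro v
    have key : ∀ S : Finset V, (∀ u ∈ S, G.Adj v u) →
        ∑ u ∈ S, a ^ d u ≤ ∑ u, adjMat G v u * a ^ d u := by
      intro S hS
      calc ∑ u ∈ S, a ^ d u = ∑ u ∈ S, adjMat G v u * a ^ d u := by
            apply Finset.sum_congr rfl
            intro u hu
            simp [adjMat, hS u hu]
        _ ≤ _ := by
            apply Finset.sum_le_sum_of_subset_of_nonneg (Finset.subset_univ _)
            intro u _ _
            apply mul_nonneg _ (by positivity)
            simp only [adjMat, Matrix.of_apply]
            split_ifs <;> norm_num
    rw [div_eq_mul_inv, ← ha]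
    rcases h v with ⟨u, w, hne, hu, hw, h1, h2⟩ | ⟨h0, s, t, u, h1, h2, h3, hs, ht, hu, h4, h5, h6⟩
    · refine le_trans ?_ (key {u, w} (by simp [hu, hw]))
      rw [Finset.sum_pair hne]
      have e1 := hpow h2
      have e2 : a ^ (d v - 1) ≤ a ^ d u := hpow (by omega)
      obtain ⟨k, hk⟩ : ∃ k, d v = k + 1 := ⟨d v - 1, by omega⟩
      rw [hk] at e1 e2 ⊢
      simp only [Nat.add_sub_cancel] at e2
      have e3 : 3 * a * a ^ (k+1) = a ^ k + a ^ (k+1+1) := by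
        have : a ^ (k+1+1) = a ^ k * (a * a) := by ring
        rw [this, ha2]
        have : 3 * a * a ^ (k+1) = 3 * a ^ k * (a * a) := by ring
        rw [this, ha2]; ring
      linarith
    · refine le_trans ?_ (key {s, t, u} (by simp [hs, ht, hu]))
      rw [Finset.sum_insert (by simp [h1, h2]), Finset.sum_pair h3, h0]
      have := hpow h4
      have := hpow h5
      have := hpow h6
      simp only [pow_one, pow_zero] at *
      linarith
  · ext u v
    simp [adjMat, G.adj_comm]

/-- Distance to the nearest vertex of degree three. -/
def dumbDist (p q ℓ : ℕ) : Fin p ⊕ (Fin q ⊕ Fin (ℓ - 1)) → ℕ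
  | Sum.inl i => min (i : ℕ) (p - i)
  | Sum.inr (Sum.inl i) => min (i : ℕ) (q - i)
  | Sum.inr (Sum.inr t) => min ((t : ℕ) + 1) (ℓ - 1 - t)

lemma cycle_nbrs (p : ℕ) (hp : 3 ≤ p) (i : Fin p) :
    ∃ u w : Fin p, u ≠ w ∧ u ≠ i ∧ w ≠ i ∧
      ((u : ℕ) = ((i : ℕ) + 1) % p ∨ (i : ℕ) = ((u : ℕ) + 1) % p) ∧
      ((w : ℕ) = ((i : ℕ) + 1) % p ∨ (i : ℕ) = ((w : ℕ) + 1) % p) ∧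
      ((i : ℕ) ≠ 0 → min (u : ℕ) (p - u) + 1 ≤ min (i : ℕ) (p - i)) ∧
      min (u : ℕ) (p - u) ≤ min (i : ℕ) (p - i) + 1 ∧
      min (w : ℕ) (p - w) ≤ min (i : ℕ) (p - i) + 1 := by
  obtain ⟨i, hi⟩ := i
  have e1 : ∀ k, k + 1 < p → (k + 1) % p = k + 1 := fun k hk => Nat.mod_eq_of_lt hk
  have e2 : (p - 1 + 1) % p = 0 := by rw [Nat.sub_add_cancel (by omega)]; exact Nat.mod_self p
  have main : ∀ a b : Fin p, (a : ℕ) = (i + 1) % p → i = ((b : ℕ) + 1) % p →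
      a ≠ b ∧ a ≠ ⟨i, hi⟩ ∧ b ≠ ⟨i, hi⟩ ∧
      min (a : ℕ) (p - a) ≤ min i (p - i) + 1 ∧
      min (b : ℕ) (p - b) ≤ min i (p - i) + 1 ∧
      (i ≠ 0 → min (a : ℕ) (p - a) + 1 ≤ min i (p - i) ∨
        min (b : ℕ) (p - b) + 1 ≤ min i (p - i)) := by
    rintro ⟨a, ha⟩ ⟨b, hb⟩ h1 h2
    simp only [ne_eq, Fin.mk.injEq] at *
    have h1' : (i + 1 < p ∧ a = i + 1) ∨ (i = p - 1 ∧ a = 0) := by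
      rcases Nat.lt_or_ge (i + 1) p with h | h
      · left; rw [e1 i h] at h1; exact ⟨h, h1⟩
      · right
        have : i = p - 1 := by omega
        subst this; rw [e2] at h1; exact ⟨rfl, h1⟩
    have h2' : (b + 1 < p ∧ i = b + 1) ∨ (b = p - 1 ∧ i = 0) := by
      rcases Nat.lt_or_ge (b + 1) p with h | h
      · left; rw [e1 b h] at h2; exact ⟨h, h2⟩
      · right
        have : b = p - 1 := by omega
        subst this; rw [e2] at h2; exact ⟨rfl, h2⟩
    clear h1 h2 e1 e2
    refine ⟨?_, ?_, ?_, ?_, ?_, ?_⟩ <;> omega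
  obtain ⟨b, hb⟩ : ∃ b : Fin p, i = ((b : ℕ) + 1) % p := by
    rcases Nat.eq_zero_or_pos i with h | h
    · exact ⟨⟨p - 1, by omega⟩, by simp only [e2]; exact h⟩
    · refine ⟨⟨i - 1, by omega⟩, ?_⟩
      simp only
      rw [e1 _ (by omega)]; omega
  have ha : (i + 1) % p < p := Nat.mod_lt _ (by omega)
  obtain ⟨m1, m2, m3, m4, m5, m6⟩ := main ⟨_, ha⟩ b rfl hb
  by_cases h : i ≠ 0 ∧ min (b : ℕ) (p - b) + 1 ≤ min i (p - i)
  · exact ⟨b, ⟨_, ha⟩, m1.symm, m3, m2, Or.inr hb, Or.inl rfl, fun _ => h.2, m5, m4⟩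
  · refine ⟨⟨_, ha⟩, b, m1, m2, m3, Or.inl rfl, Or.inr hb, fun h0 => ?_, m4, m5⟩
    rcases m6 h0 with h' | h'
    · exact h'
    · exact absurd ⟨h0, h'⟩ h

/-- For `p,q ≥ 3`, `ℓ ≥ 1`, the dumbbell graph `B(p,q,ℓ)` satisfies
`λ₁(B(p,q,ℓ)) ≥ 3/√2`. -/
theorem dumbbell_eig_ge (p q ℓ : ℕ) (hp : 3 ≤ p) (hq : 3 ≤ q) (hℓ : 1 ≤ ℓ) :
    3 / Real.sqrt 2 ≤ graphEig (dumbbell p q ℓ) 1 := by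
  have : Nonempty (Fin p ⊕ (Fin q ⊕ Fin (ℓ - 1))) := ⟨Sum.inl ⟨0, by omega⟩⟩
  apply graph_bound _ (dumbDist p q ℓ)
  rintro (i | i | t)
  · obtain ⟨u, w, huw, hu, hw, au, aw, d1, d2, d3⟩ := cycle_nbrs p hp i
    have Au : (dumbbell p q ℓ).Adj (Sum.inl i) (Sum.inl u) := by
      simp [dumbbell, SimpleGraph.fromRel_adj, hu.symm, au]
    have Aw : (dumbbell p q ℓ).Adj (Sum.inl i) (Sum.inl w) := by
      simp [dumbbell, SimpleGraph.fromRel_adj, hw.symm, aw]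
    by_cases h0 : (i : ℕ) = 0
    · right
      refine ⟨by simp [dumbDist, h0], ?_⟩
      rw [h0] at d2 d3
      simp only [Nat.zero_min, Nat.zero_add] at d2 d3
      rcases Nat.lt_or_ge 1 ℓ with h | h
      · refine ⟨Sum.inl u, Sum.inl w, Sum.inr (Sum.inr ⟨0, by omega⟩), by simpa using huw,
          by simp, by simp, Au, Aw, ?_, d2, d3, ?_⟩
        · simp [dumbbell, SimpleGraph.fromRel_adj, h0]
        · simp [dumbDist]
      · refine ⟨Sum.inl u, Sum.inl w, Sum.inr (Sum.inl ⟨0, by omega⟩), by simpa using huw,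
          by simp, by simp, Au, Aw, ?_, d2, d3, ?_⟩
        · simp [dumbbell, SimpleGraph.fromRel_adj, h0]; omega
        · simp [dumbDist]
    · left
      exact ⟨Sum.inl u, Sum.inl w, by simpa using huw, Au, Aw, d1 h0, d3⟩
  · obtain ⟨u, w, huw, hu, hw, au, aw, d1, d2, d3⟩ := cycle_nbrs q hq i
    have Au : (dumbbell p q ℓ).Adj (Sum.inr (Sum.inl i)) (Sum.inr (Sum.inl u)) := by
      simp [dumbbell, SimpleGraph.fromRel_adj, hu.symm, au]
    have Aw : (dumbbell p q ℓ).Adj (Sum.inr (Sum.inl i)) (Sum.inr (Sum.inl w)) := by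
      simp [dumbbell, SimpleGraph.fromRel_adj, hw.symm, aw]
    by_cases h0 : (i : ℕ) = 0
    · right
      refine ⟨by simp [dumbDist, h0], ?_⟩
      rw [h0] at d2 d3
      simp only [Nat.zero_min, Nat.zero_add] at d2 d3
      rcases Nat.lt_or_ge 1 ℓ with h | h
      · refine ⟨Sum.inr (Sum.inl u), Sum.inr (Sum.inl w), Sum.inr (Sum.inr ⟨ℓ - 2, by omega⟩),
          by simpa using huw, by simp, by simp, Au, Aw, ?_, d2, d3, ?_⟩
        · simp [dumbbell, SimpleGraph.fromRel_adj, h0]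
        · simp only [dumbDist]; omega
      · refine ⟨Sum.inr (Sum.inl u), Sum.inr (Sum.inl w), Sum.inl ⟨0, by omega⟩,
          by simpa using huw, by simp, by simp, Au, Aw, ?_, d2, d3, ?_⟩
        · simp [dumbbell, SimpleGraph.fromRel_adj, h0]; omega
        · simp [dumbDist]
    · left
      exact ⟨Sum.inr (Sum.inl u), Sum.inr (Sum.inl w), by simpa using huw, Au, Aw, d1 h0, d3⟩
  · left
    obtain ⟨t, ht⟩ := t
    -- left neighbour
    obtain ⟨u, Au, du, hu⟩ : ∃ u, (dumbbell p q ℓ).Adj (Sum.inr (Sum.inr ⟨t, ht⟩)) u ∧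
        dumbDist p q ℓ u = min t (ℓ - t) ∧
        ((∃ a, u = Sum.inl a) ∨ ∃ s, u = Sum.inr (Sum.inr s) ∧ (s : ℕ) < t) := by
      rcases Nat.eq_zero_or_pos t with h | h
      · refine ⟨Sum.inl ⟨0, by omega⟩, ?_, ?_, Or.inl ⟨_, rfl⟩⟩
        · simp [dumbbell, SimpleGraph.fromRel_adj, h]
        · simp [dumbDist, h]
      · refine ⟨Sum.inr (Sum.inr ⟨t - 1, by omega⟩), ?_, ?_,
          Or.inr ⟨_, rfl, by simp only; omega⟩⟩
        · simp [dumbbell, SimpleGraph.fromRel_adj]; omega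
        · simp only [dumbDist]; omega
    obtain ⟨w, Aw, dw, hw⟩ : ∃ w, (dumbbell p q ℓ).Adj (Sum.inr (Sum.inr ⟨t, ht⟩)) w ∧
        dumbDist p q ℓ w = min (t + 2) (ℓ - 2 - t) ∧
        ((∃ a, w = Sum.inr (Sum.inl a)) ∨ ∃ s, w = Sum.inr (Sum.inr s) ∧ t < (s : ℕ)) := by
      rcases Nat.lt_or_ge (t + 1) (ℓ - 1) with h | h
      · refine ⟨Sum.inr (Sum.inr ⟨t + 1, by omega⟩), ?_, ?_,
          Or.inr ⟨_, rfl, by simp only; omega⟩⟩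
        · simp [dumbbell, SimpleGraph.fromRel_adj]
        · simp only [dumbDist]; omega
      · refine ⟨Sum.inr (Sum.inl ⟨0, by omega⟩), ?_, ?_, Or.inl ⟨_, rfl⟩⟩
        · simp [dumbbell, SimpleGraph.fromRel_adj]; omega
        · simp only [dumbDist]; omega
    have huw : u ≠ w := by
      rintro rfl
      rcases hu with ⟨a, rfl⟩ | ⟨s, rfl, hs⟩ <;> rcases hw with ⟨b, hb⟩ | ⟨s', hb, hs'⟩ <;>
        simp at hb
      subst hb; omega
    have dv : dumbDist p q ℓ (Sum.inr (Sum.inr ⟨t, ht⟩)) = min (t + 1) (ℓ - 1 - t) := rfl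
    by_cases h : t + 1 ≤ ℓ - 1 - t
    · exact ⟨u, w, huw, Au, Aw, by omega, by omega⟩
    · exact ⟨w, u, huw.symm, Aw, Au, by omega, by omega⟩
end

section
/- Let G be a connected finite simple tree and k ≥ 2. Then the multiplicity of the k-th largest adjacency eigenvalue of G is at most (k−1)·Δ, where Δ is the maximum degree of G. In particular, the multiplicity of the second largest adjacency eigenvalue of a tree is at most its maximum degree. -/
open scoped Classical

section Helpers

variable {V : Type*} [Fintype V] [DecidableEq V]

/-- Row `v` of `(diag d + A) x`. -/
noncomputable def rowF (G : SimpleGraph V) (d x : V → ℝ) (v : V) : ℝ :=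
  d v * x v + ∑ w, adjMat G v w * x w

/-- The quadratic form of `diag d + A`. -/
noncomputable def quadF (G : SimpleGraph V) (d x : V → ℝ) : ℝ :=
  ∑ v, x v * rowF G d x v

/-- Neighbours inside `S`. -/
noncomputable def nbrIn (G : SimpleGraph V) (S : Finset V) (u : V) : Finset V :=
  S.filter (fun w => G.Adj u w)

lemma adjMat_symm' (G : SimpleGraph V) (u v : V) : adjMat G u v = adjMat G v u := by
  simp [adjMat, G.adj_comm]

lemma adjMat_self (G : SimpleGraph V) (u : V) : adjMat G u u = 0 := by
  simp [adjMat]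

lemma rowF_add_single (G : SimpleGraph V) (d x : V → ℝ) (u : V) (t : ℝ) (v : V) :
    rowF G d (x + Pi.single u t) v
      = rowF G d x v + (if v = u then d u * t else 0) + adjMat G v u * t := by
  have : ∑ w, adjMat G v w * (x + Pi.single u t : V → ℝ) w
      = ∑ w, adjMat G v w * x w + adjMat G v u * t := by
    simp [mul_add, Finset.sum_add_distrib, Pi.single_apply]
  rw [rowF, rowF, this]
  by_cases h : v = u
  · subst h; simp; ring
  · simp [h]; ring

lemma sum_mul_row_comm (G : SimpleGraph V) (d x : V → ℝ) (u : V) :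
    ∑ v, x v * adjMat G v u = ∑ w, adjMat G u w * x w := by
  refine Finset.sum_congr rfl fun v _ => ?_
  rw [adjMat_symm' G v u, mul_comm]

lemma quadF_add_single (G : SimpleGraph V) (d x : V → ℝ) (u : V) (t : ℝ) :
    quadF G d (x + Pi.single u t) = quadF G d x + 2 * t * rowF G d x u + t ^ 2 * d u := by
  have h1 : quadF G d (x + Pi.single u t)
      = ∑ v, x v * rowF G d (x + Pi.single u t) v + t * rowF G d (x + Pi.single u t) u := by
    simp [quadF, add_mul, Finset.sum_add_distrib, Pi.single_apply]
  have h2 : ∑ v, x v * rowF G d (x + Pi.single u t) v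
      = quadF G d x + x u * (d u * t) + (∑ v, x v * adjMat G v u) * t := by
    simp only [rowF_add_single, mul_add, Finset.sum_add_distrib, quadF, Finset.sum_mul]
    simp [mul_assoc]
  rw [h1, h2, rowF_add_single, sum_mul_row_comm G d, adjMat_self]
  simp only [rowF, if_true]
  ring

lemma rowF_update (G : SimpleGraph V) (d x : V → ℝ) (v : V) (c : ℝ) (w : V) :
    rowF G (Function.update d v c) x w
      = rowF G d x w + if w = v then (c - d v) * x v else 0 := by
  by_cases h : w = v
  · subst h; simp [rowF]; ring
  · simp [rowF, h]

lemma quadF_update (G : SimpleGraph V) (d x : V → ℝ) (v : V) (c : ℝ) :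
    quadF G (Function.update d v c) x = quadF G d x + (c - d v) * x v ^ 2 := by
  simp only [quadF, rowF_update, mul_add, Finset.sum_add_distrib]
  simp; ring

lemma row_sum_eq (G : SimpleGraph V) (S : Finset V) (x : V → ℝ) (hx : ∀ v ∉ S, x v = 0) (u : V) :
    ∑ w, adjMat G u w * x w = ∑ w ∈ nbrIn G S u, x w := by
  rw [nbrIn, Finset.sum_filter, ← Finset.sum_subset (Finset.subset_univ S)]
  · refine Finset.sum_congr rfl fun w _ => ?_
    simp [adjMat]
  · intro w _ hw
    simp [hx w hw]

lemma degsum_erase (G : SimpleGraph V) (S : Finset V) (u : V) (hu : u ∈ S) :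
    ∑ v ∈ S, (nbrIn G S v).card
      = ∑ v ∈ S.erase u, (nbrIn G (S.erase u) v).card + 2 * (nbrIn G S u).card := by
  have key : ∀ v, (nbrIn G S v).card
      = (nbrIn G (S.erase u) v).card + if G.Adj v u then 1 else 0 := by
    intro v
    simp only [nbrIn, Finset.card_filter]
    rw [← Finset.sum_erase_add S _ hu]
  have h3 : (nbrIn G (S.erase u) u).card = ∑ v ∈ S.erase u, if G.Adj v u then 1 else 0 := by
    simp only [nbrIn, Finset.card_filter, G.adj_comm]
  have h4 := key u
  simp only [SimpleGraph.irrefl, if_false, add_zero] at h4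
  rw [← Finset.sum_erase_add S _ hu, Finset.sum_congr rfl (fun v _ => key v),
    Finset.sum_add_distrib, ← h3, ← h4]
  ring

/-- Zeroing coordinate `u`. -/
noncomputable def zeroAt (u : V) : (V → ℝ) →ₗ[ℝ] (V → ℝ) :=
  LinearMap.id - (LinearMap.single ℝ (fun _ : V => ℝ) u) ∘ₗ (LinearMap.proj u)

lemma zeroAt_apply (u : V) (x : V → ℝ) : zeroAt u x = x + Pi.single u (-x u) := by
  ext v
  by_cases h : v = u
  · subst h; simp [zeroAt]
  · simp [zeroAt, h]

lemma zeroAt_self (u : V) (x : V → ℝ) : zeroAt u x u = 0 := by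
  simp [zeroAt_apply]

lemma zeroAt_ne (u v : V) (h : v ≠ u) (x : V → ℝ) : zeroAt u x v = x v := by
  simp [zeroAt_apply, h]

lemma finrank_map_zeroAt (u : V) (N : Submodule ℝ (V → ℝ))
    (h : ∀ x ∈ N, (∀ v, v ≠ u → x v = 0) → x u = 0) :
    Module.finrank ℝ (N.map (zeroAt u)) = Module.finrank ℝ N := by
  have hr : LinearMap.range ((zeroAt u).domRestrict N) = N.map (zeroAt u) :=
    LinearMap.range_domRestrict _ _
  rw [← hr]
  refine LinearMap.finrank_range_of_inj ?_
  rw [injective_iff_map_eq_zero]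
  rintro ⟨x, hx⟩ h0
  have h0' : zeroAt u x = 0 := h0
  have hz : ∀ v, v ≠ u → x v = 0 := fun v hv => by
    rw [← zeroAt_ne u v hv x, h0']; rfl
  ext v
  by_cases hv : v = u
  · subst hv; exact h x hx hz
  · exact hz v hv

lemma finrank_le_map_zeroAt (u : V) (N : Submodule ℝ (V → ℝ)) :
    Module.finrank ℝ N ≤ Module.finrank ℝ (N.map (zeroAt u)) + 1 := by
  have hr : LinearMap.range ((zeroAt u).domRestrict N) = N.map (zeroAt u) :=
    LinearMap.range_domRestrict _ _
  rw [← hr, ← LinearMap.finrank_range_add_finrank_ker ((zeroAt u).domRestrict N)]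
  gcongr
  have := LinearMap.finrank_le_finrank_of_injective
    (f := (LinearMap.proj u : (V → ℝ) →ₗ[ℝ] ℝ) ∘ₗ N.subtype ∘ₗ
      (LinearMap.ker ((zeroAt u).domRestrict N)).subtype) (by
      rw [injective_iff_map_eq_zero]
      rintro ⟨⟨x, hx⟩, h0⟩ h1
      have h0' : zeroAt u x = 0 := h0
      have h1' : x u = 0 := h1
      ext v
      by_cases hv : v = u
      · subst hv; exact h1'
      · change x v = 0
        rw [← zeroAt_ne u v hv x, h0']; rfl)
  simpa using this

theorem inertia_core (G : SimpleGraph V) (e : ℕ)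
    (hdeg : ∀ v, (nbrIn G Finset.univ v).card ≤ e + 2)
    (hleaf : ∀ S : Finset V, S.Nonempty → ∃ u ∈ S, (nbrIn G S u).card ≤ 1) :
    ∀ n, ∀ S : Finset V, S.card = n → ∀ (d : V → ℝ) (N : Submodule ℝ (V → ℝ)),
      (∀ x ∈ N, (∀ v ∉ S, x v = 0) ∧ ∀ v ∈ S, rowF G d x v = 0) →
      ∃ (p : ℕ) (f : (Fin p → ℝ) →ₗ[ℝ] (V → ℝ)), (∀ a, ∀ v ∉ S, f a v = 0) ∧
        (∀ a, a ≠ 0 → 0 < quadF G d (f a)) ∧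
        2 * Module.finrank ℝ N + ∑ v ∈ S, (nbrIn G S v).card ≤ 2 * (p * e + S.card) := by
  intro n
  induction n using Nat.strong_induction_on with
  | _ n ih =>
  intro S hS d N hN
  rcases S.eq_empty_or_nonempty with rfl | hne
  · refine ⟨0, 0, by simp, fun a ha => absurd (Subsingleton.elim a 0) ha, ?_⟩
    have : N = ⊥ := by
      rw [eq_bot_iff]
      intro x hx
      rw [Submodule.mem_bot]
      ext v
      exact (hN x hx).1 v (by simp)
    subst this
    simp
  obtain ⟨u, hu, hcard⟩ := hleaf S hne
  have hSu : (S.erase u).card + 1 = S.card := Finset.card_erase_add_one hu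
  have hsup : ∀ x : V → ℝ, (∀ v ∉ S, x v = 0) → ∀ v ∉ S.erase u, zeroAt u x v = 0 := by
    intro x hx v hv
    by_cases h : v = u
    · subst h; exact zeroAt_self _ _
    · rw [zeroAt_ne u v h]
      exact hx v fun h' => hv (Finset.mem_erase.2 ⟨h, h'⟩)
  have hds := degsum_erase G S u hu
  rcases Nat.le_one_iff_eq_zero_or_eq_one.1 hcard with h0 | h1
  · -- isolated vertex
    have hnb : nbrIn G S u = ∅ := Finset.card_eq_zero.1 h0
    have hnadj : ∀ w ∈ S, adjMat G w u = 0 := by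
      intro w hw
      have : w ∉ nbrIn G S u := by simp [hnb]
      simp only [nbrIn, Finset.mem_filter, not_and] at this
      have := this hw
      rw [adjMat_symm']
      simp [adjMat, this]
    obtain ⟨p, f, hf1, hf2, hf3⟩ := ih (S.erase u).card (by omega) (S.erase u) rfl d
      (N.map (zeroAt u)) (by
        rintro _ ⟨x, hx, rfl⟩
        refine ⟨hsup x (hN x hx).1, fun v hv => ?_⟩
        have hv' := Finset.mem_erase.1 hv
        rw [zeroAt_apply, rowF_add_single, (hN x hx).2 v hv'.2, hnadj v hv'.2]
        simp [hv'.1])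
    refine ⟨p, f, fun a v hv => hf1 a v fun h => hv (Finset.mem_of_mem_erase h), hf2, ?_⟩
    have := finrank_le_map_zeroAt u N
    rw [hds, h0]
    have h2 : 2 * (p * e + S.card) = 2 * (p * e + (S.erase u).card) + 2 := by rw [← hSu]; ring
    omega
  obtain ⟨v, hnb⟩ := Finset.card_eq_one.1 h1
  have hvmem : v ∈ nbrIn G S u := by simp [hnb]
  have hvS : v ∈ S := (Finset.mem_filter.1 hvmem).1
  have huv : G.Adj u v := (Finset.mem_filter.1 hvmem).2
  have hvu : v ≠ u := huv.ne'
  have hrow : ∀ x : V → ℝ, (∀ v ∉ S, x v = 0) → rowF G d x u = d u * x u + x v := by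
    intro x hx
    rw [rowF, row_sum_eq G S x hx, hnb, Finset.sum_singleton]
  have hAv : adjMat G v u = 1 := by simp [adjMat, huv.symm]
  have hAne : ∀ w ∈ S, w ≠ v → adjMat G w u = 0 := by
    intro w hw hwv
    have : w ∉ nbrIn G S u := by simp [hnb, hwv]
    simp only [nbrIn, Finset.mem_filter, not_and] at this
    have := this hw
    rw [adjMat_symm']
    simp [adjMat, this]
  by_cases hd : d u = 0
  · -- hyperbolic pair
    have hvE : v ∈ S.erase u := Finset.mem_erase.2 ⟨hvu, hvS⟩
    have hSv : ((S.erase u).erase v).card + 1 = (S.erase u).card := Finset.card_erase_add_one hvE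
    have hxv : ∀ x ∈ N, x v = 0 := by
      intro x hx
      have := (hN x hx).2 u hu
      rw [hrow x (hN x hx).1, hd] at this
      simpa using this
    obtain ⟨p, f, hf1, hf2, hf3⟩ := ih ((S.erase u).erase v).card (by omega)
      ((S.erase u).erase v) rfl d (N.map (zeroAt u)) (by
        rintro _ ⟨x, hx, rfl⟩
        refine ⟨fun w hw => ?_, fun w hw => ?_⟩
        · by_cases hwv : w = v
          · subst hwv
            rw [zeroAt_ne _ _ hvu, hxv x hx]
          · exact hsup x (hN x hx).1 w fun h => hw (Finset.mem_erase.2 ⟨hwv, h⟩)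
        · simp only [Finset.mem_erase] at hw
          rw [zeroAt_apply, rowF_add_single, (hN x hx).2 w hw.2.2, hAne w hw.2.2 hw.1]
          simp [hw.2.1])
    have hfr := finrank_map_zeroAt u N (by
      intro x hx hz
      have h := (hN x hx).2 v hvS
      have hx' : x = 0 + Pi.single u (x u) := by
        ext w
        by_cases hw : w = u
        · subst hw; simp
        · simp [hw, hz w hw]
      rw [hx', rowF_add_single, hAv] at h
      simpa [hvu, rowF] using h)
    -- the lifted map
    let tl : (Fin (p + 1) → ℝ) →ₗ[ℝ] (Fin p → ℝ) := LinearMap.funLeft ℝ ℝ Fin.succ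
    let hd0 : (Fin (p + 1) → ℝ) →ₗ[ℝ] ℝ := LinearMap.proj 0
    let rw0 : (V → ℝ) →ₗ[ℝ] ℝ := ∑ w, adjMat G v w • (LinearMap.proj w : (V → ℝ) →ₗ[ℝ] ℝ)
    let g : (Fin (p + 1) → ℝ) →ₗ[ℝ] (V → ℝ) :=
      f ∘ₗ tl + (LinearMap.single ℝ (fun _ : V => ℝ) v) ∘ₗ hd0
        + (LinearMap.single ℝ (fun _ : V => ℝ) u) ∘ₗ
            (((1 - d v) / 2) • hd0 - rw0 ∘ₗ f ∘ₗ tl)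
    have hg : ∀ a, g a = f (tl a) + Pi.single v (a 0)
        + Pi.single u ((1 - d v) / 2 * a 0 - ∑ w, adjMat G v w * f (tl a) w) := by
      intro a
      simp [g, hd0, rw0]
    refine ⟨p + 1, g, ?_, ?_, ?_⟩
    · intro a w hw
      have hwu : w ≠ u := fun h => hw (h ▸ hu)
      have hwv : w ≠ v := fun h => hw (h ▸ hvS)
      rw [hg]
      simp [hwu, hwv, hf1 (tl a) w (by simp [hw])]
    · intro a ha
      have hq : quadF G d (g a) = quadF G d (f (tl a)) + a 0 ^ 2 := by
        have hs : ∀ w ∉ S, f (tl a) w = 0 := fun w hw => hf1 _ w (by simp [hw])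
        have hfv : f (tl a) v = 0 := hf1 _ v (by simp)
        have hfu : f (tl a) u = 0 := hf1 _ u (by simp)
        have hs2 : ∀ w ∉ S, (f (tl a) + Pi.single v (a 0) : V → ℝ) w = 0 := by
          intro w hw
          have hwv : w ≠ v := fun h => hw (h ▸ hvS)
          simp [hwv, hs w hw]
        rw [hg, quadF_add_single, hrow _ hs2, quadF_add_single, hd, rowF, hfv]
        simp [hfv]
        ring
      rw [hq]
      by_cases ht : tl a = 0
      · have ha0 : a 0 ≠ 0 := by
          intro h
          apply ha
          ext i
          refine Fin.cases h (fun j => ?_) i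
          exact congrFun ht j
        have : quadF G d (f (tl a)) = 0 := by rw [ht]; simp [quadF]
        rw [this, zero_add]
        positivity
      · have := hf2 _ ht
        positivity
    · have hds2 := degsum_erase G (S.erase u) v hvE
      have hlt : (nbrIn G (S.erase u) v).card + 1 ≤ e + 2 := by
        refine le_trans ?_ (hdeg v)
        refine Finset.card_lt_card ?_
        refine Finset.ssubset_iff_subset_ne.2 ⟨Finset.filter_subset_filter _ (Finset.subset_univ _), ?_⟩
        intro h
        have : u ∈ nbrIn G (S.erase u) v := by rw [h]; simp [nbrIn, huv.symm]
        simp [nbrIn] at this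
      rw [hds, h1, hds2, ← hfr]
      have h2 : 2 * ((p + 1) * e + S.card)
          = 2 * (p * e + ((S.erase u).erase v).card) + 2 * e + 4 := by
        rw [← hSu, ← hSv]; ring
      omega
  · -- Schur complement
    obtain ⟨p, f, hf1, hf2, hf3⟩ := ih (S.erase u).card (by omega) (S.erase u) rfl
      (Function.update d v (d v - 1 / d u)) (N.map (zeroAt u)) (by
        rintro _ ⟨x, hx, rfl⟩
        refine ⟨hsup x (hN x hx).1, fun w hw => ?_⟩
        have hw' := Finset.mem_erase.1 hw
        have hr := (hN x hx).2 u hu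
        rw [hrow x (hN x hx).1] at hr
        rw [rowF_update, zeroAt_ne _ _ hvu, zeroAt_apply, rowF_add_single, (hN x hx).2 w hw'.2]
        by_cases hwv : w = v
        · subst hwv
          simp only [hw'.1, if_false, hAv, if_true]
          field_simp
          linarith
        · simp [hAne w hw'.2 hwv, hw'.1, hwv])
    have hfr := finrank_map_zeroAt u N (by
      intro x hx hz
      have hr := (hN x hx).2 u hu
      rw [hrow x (hN x hx).1, hz v hvu] at hr
      simpa [hd] using hr)
    let g : (Fin p → ℝ) →ₗ[ℝ] (V → ℝ) :=
      f + (LinearMap.single ℝ (fun _ : V => ℝ) u) ∘ₗ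
        ((-(1 / d u)) • ((LinearMap.proj v : (V → ℝ) →ₗ[ℝ] ℝ) ∘ₗ f))
    have hg : ∀ a, g a = f a + Pi.single u (-(1 / d u) * f a v) := by
      intro a
      simp [g]
    refine ⟨p, g, ?_, ?_, ?_⟩
    · intro a w hw
      have hwu : w ≠ u := fun h => hw (h ▸ hu)
      rw [hg]
      simp [hwu, hf1 a w (by simp [hw])]
    · intro a ha
      have h := hf2 a ha
      rw [quadF_update] at h
      have hs : ∀ w ∉ S, f a w = 0 := fun w hw => hf1 _ w (by simp [hw])
      have hfu : f a u = 0 := hf1 _ u (by simp)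
      rw [hg, quadF_add_single, hrow _ hs, hfu]
      convert h using 1
      field_simp
      ring
    · rw [hds, h1, ← hfr]
      have h2 : 2 * (p * e + S.card) = 2 * (p * e + (S.erase u).card) + 2 := by rw [← hSu]; ring
      omega

lemma tree_leaf (G : SimpleGraph V) (hG : G.IsTree) (S : Finset V) (hS : S.Nonempty) :
    ∃ u ∈ S, (nbrIn G S u).card ≤ 1 := by
  obtain ⟨r, hr⟩ := hS
  obtain ⟨u, hu, hmax⟩ := S.exists_max_image (fun w => G.dist r w) ⟨r, hr⟩
  refine ⟨u, hu, Finset.card_le_one.2 ?_⟩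
  have key : ∀ w ∈ nbrIn G S u, ∃ (p : G.Walk r u), p.IsPath ∧ p.penultimate = w := by
    intro w hw
    obtain ⟨hwS, hadj⟩ := Finset.mem_filter.1 hw
    obtain ⟨q, hq⟩ := hG.connected.exists_walk_length_eq_dist r w
    have h1 := hmax w hwS
    have h2 := hG.dist_eq_dist_add_one_of_adj r hadj
    refine ⟨q.concat hadj.symm, ?_, by simp⟩
    refine SimpleGraph.Walk.isPath_of_length_eq_dist _ ?_
    rw [SimpleGraph.Walk.length_concat, hq]
    omega
  intro a ha b hb
  obtain ⟨p, hp, rfl⟩ := key a ha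
  obtain ⟨q, hq, rfl⟩ := key b hb
  rw [(hG.existsUnique_path r u).unique hp hq]

/-- A subspace on which `A - μ` is positive definite has dimension at most the number of
eigenvalues exceeding `μ`. -/
lemma pos_dim_le (A : Matrix V V ℝ) (hA : A.IsHermitian) (μ : ℝ) (p : ℕ)
    (f : (Fin p → ℝ) →ₗ[ℝ] (V → ℝ))
    (hf : ∀ a, a ≠ 0 → μ * (f a ⬝ᵥ f a) < f a ⬝ᵥ A.mulVec (f a)) :
    p ≤ (Finset.univ.filter fun i => μ < hA.eigenvalues i).card := by
  let U : Matrix V V ℝ := hA.eigenvectorUnitary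
  have hUU : U * U.transpose = 1 := by
    have := Matrix.UnitaryGroup.star_mul_self (star hA.eigenvectorUnitary)
    simpa [U, Matrix.star_eq_conjTranspose, Matrix.conjTranspose_eq_transpose_of_trivial] using this
  have hsp : A = U * Matrix.diagonal hA.eigenvalues * U.transpose := by
    have := hA.spectral_theorem
    rw [Unitary.conjStarAlgAut_apply] at this
    simpa [U, Matrix.star_eq_conjTranspose, Matrix.conjTranspose_eq_transpose_of_trivial,
      Function.comp_def] using this
  have q1 : ∀ x : V → ℝ, x ⬝ᵥ x = ∑ i, (U.transpose.mulVec x i) ^ 2 := by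
    intro x
    have : x ⬝ᵥ x = x ⬝ᵥ (U * U.transpose).mulVec x := by rw [hUU, Matrix.one_mulVec]
    rw [this, ← Matrix.mulVec_mulVec, Matrix.dotProduct_mulVec, ← Matrix.mulVec_transpose]
    simp [dotProduct, sq]
  have q2 : ∀ x : V → ℝ, x ⬝ᵥ A.mulVec x
      = ∑ i, hA.eigenvalues i * (U.transpose.mulVec x i) ^ 2 := by
    intro x
    conv_lhs => rw [hsp]
    rw [← Matrix.mulVec_mulVec, ← Matrix.mulVec_mulVec, Matrix.dotProduct_mulVec,
      ← Matrix.mulVec_transpose]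
    simp only [dotProduct, Matrix.mulVec_diagonal]
    refine Finset.sum_congr rfl fun i _ => by ring
  let L : (Fin p → ℝ) →ₗ[ℝ] ({i // μ < hA.eigenvalues i} → ℝ) :=
    LinearMap.funLeft ℝ ℝ Subtype.val ∘ₗ U.transpose.mulVecLin ∘ₗ f
  have hL : Function.Injective L := by
    rw [injective_iff_map_eq_zero]
    intro a ha
    by_contra hne
    have h := hf a hne
    rw [q1, q2, Finset.mul_sum] at h
    refine absurd h (not_lt.2 (Finset.sum_le_sum fun i _ => ?_))
    by_cases hi : μ < hA.eigenvalues i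
    · have : U.transpose.mulVec (f a) i = 0 := congrFun ha ⟨i, hi⟩
      rw [this]; simp
    · exact mul_le_mul_of_nonneg_right (not_lt.1 hi) (sq_nonneg _)
  have := LinearMap.finrank_le_finrank_of_injective hL
  simpa [Fintype.card_subtype] using this

lemma sorted_count (l : List ℝ) (hl : l.Pairwise (· ≤ ·)) (k : ℕ) (hk1 : 1 ≤ k)
    (hk : k ≤ l.length) :
    l.countP (fun x => decide (l.getD (l.length - k) 0 < x)) ≤ k - 1 := by
  have hlt : l.length - k < l.length := by omega
  have hget : l.getD (l.length - k) 0 = l[l.length - k] := by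
    simp [List.getD, hlt]
  rw [hget]
  set c := l[l.length - k] with hc
  conv_lhs => rw [← List.take_append_drop (l.length - k + 1) l]
  rw [List.countP_append]
  have h1 : (l.take (l.length - k + 1)).countP (fun x => decide (c < x)) = 0 := by
    rw [List.countP_eq_zero]
    intro x hx
    obtain ⟨i, hi, rfl⟩ := List.mem_iff_getElem.1 hx
    simp only [List.length_take] at hi
    simp only [decide_eq_true_eq, not_lt, List.getElem_take, hc]
    rcases Nat.lt_or_ge i (l.length - k) with h | h
    · exact List.pairwise_iff_getElem.1 hl _ _ _ _ h
    · have : i = l.length - k := by omega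
      subst this; exact le_rfl
  have h2 : (l.drop (l.length - k + 1)).countP (fun x => decide (c < x)) ≤ _ :=
    List.countP_le_length
  rw [List.length_drop] at h2
  omega

end Helpers

/-- For a finite tree `G` and `2 ≤ k ≤ |V|`, the multiplicity of
`λₖ(G)` is at most `(k-1)·Δ` where `Δ` is the maximum degree; in particular the
multiplicity of the second largest adjacency eigenvalue of a tree is at most `Δ`. -/
theorem eigMult_le_of_tree {V : Type*} [Fintype V] [DecidableEq V]
    (G : SimpleGraph V) (hG : G.IsTree) (k : ℕ) (hk1 : 2 ≤ k)
    (hk2 : k ≤ Fintype.card V) :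
    eigMult (adjMat G) (graphEig G k) ≤ (k - 1) * maxDeg G := by
  set μ := graphEig G k with hμ
  have hA : (adjMat G).IsHermitian := by
    ext u v
    simp [adjMat, G.adj_comm]
  have hcnt : (Finset.univ.filter fun i => μ < hA.eigenvalues i).card ≤ k - 1 := by
    have hroots := hA.roots_charpoly_eq_eigenvalues
    have hlen : (eigList (adjMat G)).length = Fintype.card V := by
      simp [eigList, hroots]
    have h := sorted_count (eigList (adjMat G)) (Multiset.pairwise_sort _ _) k (by omega)
      (by omega)
    refine le_trans (le_of_eq ?_) h
    change _ = List.countP (fun x => decide (μ < x)) _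
    have h2 : (Multiset.countP (fun x => μ < x) (eigList (adjMat G) : Multiset ℝ))
        = List.countP (fun x => decide (μ < x)) (eigList (adjMat G)) := by
      rw [Multiset.coe_countP]
    rw [← h2, eigList, Multiset.sort_eq, hroots, Multiset.countP_map]
    rfl
  have hdegle : ∀ v, (nbrIn G Finset.univ v).card ≤ maxDeg G := by
    intro v
    have : nbrIn G Finset.univ v = (G.neighborSet v).toFinite.toFinset := by
      ext w; simp [nbrIn]
    rw [this]
    exact Finset.le_sup (f := fun v => (G.neighborSet v).toFinite.toFinset.card)
      (Finset.mem_univ v)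
  have hsum : ∑ v, (nbrIn G Finset.univ v).card + 2 = 2 * Fintype.card V := by
    have h1 := G.sum_degrees_eq_twice_card_edges
    have h2 := hG.card_edgeFinset
    have h3 : ∀ v, (nbrIn G Finset.univ v).card = G.degree v := by
      intro v
      rw [← SimpleGraph.card_neighborFinset_eq_degree]
      congr 1
      ext w; simp [nbrIn]
    simp only [h3]
    rw [h1]
    omega
  have hpos : 1 ≤ maxDeg G := by
    by_contra h
    have h0 : ∀ v, (nbrIn G Finset.univ v).card = 0 := fun v => by
      have := hdegle v; omega
    simp only [h0, Finset.sum_const_zero] at hsum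
    omega
  obtain ⟨p, f, -, hf2, hf3⟩ := inertia_core G (maxDeg G - 2)
    (fun v => (hdegle v).trans (by omega)) (fun S hS => tree_leaf G hG S hS) _ Finset.univ rfl
    (fun _ => -μ) (LinearMap.ker ((adjMat G).mulVecLin - μ • LinearMap.id)) (by
      intro x hx
      refine ⟨fun v hv => absurd (Finset.mem_univ v) hv, fun v _ => ?_⟩
      have := congrFun (LinearMap.mem_ker.1 hx) v
      simp [Matrix.mulVec, dotProduct] at this
      rw [rowF]; linarith)
  have hp := pos_dim_le (adjMat G) hA μ p f (by
    intro a ha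
    have h := hf2 a ha
    have h2 : quadF G (fun _ => -μ) (f a)
        = f a ⬝ᵥ (adjMat G).mulVec (f a) - μ * (f a ⬝ᵥ f a) := by
      simp only [quadF, rowF, dotProduct, Matrix.mulVec, Finset.mul_sum, mul_add,
        Finset.sum_add_distrib]
      have : ∑ v, f a v * (-μ * f a v) = - ∑ v, μ * (f a v * f a v) := by
        rw [← Finset.sum_neg_distrib]
        exact Finset.sum_congr rfl fun v _ => by ring
      rw [this]; ring
    rw [h2] at h
    linarith)
  have hpk : p ≤ k - 1 := hp.trans hcnt
  rw [Finset.card_univ] at hf3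
  have hm : eigMult (adjMat G) μ ≤ p * (maxDeg G - 2) + 1 := by
    unfold eigMult
    omega
  refine hm.trans ?_
  have h5 : p * (maxDeg G - 2) ≤ (k - 1) * (maxDeg G - 2) := Nat.mul_le_mul_right _ hpk
  have h6 : (k - 1) * (maxDeg G - 2) + 1 ≤ (k - 1) * (maxDeg G - 2 + 1) := by
    rw [mul_add]; omega
  have h7 : (k - 1) * (maxDeg G - 2 + 1) ≤ (k - 1) * maxDeg G :=
    Nat.mul_le_mul_left _ (by omega)
  omega
end
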